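/- Let 𝔤 be a finite-dimensional complex Lie algebra and ρ a Lie algebra automorphism of 𝔤. Then each of the subspaces 𝔤⁺ = ⨁_{|α|>1} 𝔤_α, 𝔤⁰ = ⨁_{|α|=1} 𝔤_α, and 𝔤⁻ = ⨁_{|α|<1} 𝔤_α (sums of generalized eigenspaces of ρ) is closed under the Lie bracket, i.e., each is a Lie subalgebra of 𝔤. -/

import Mathlib

namespace Module.End

section

variable {R M : Type*} [CommRing R] [AddCommGroup M] [Module R M]

lemma mem_maxGenEigenspace_of_sub_mem {f : End R M} {a : R} {x : M}
    (h : f x - a • x ∈ f.maxGenEigenspace a) : x ∈ f.maxGenEigenspace a := by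
  rw [mem_maxGenEigenspace] at h ⊢
  obtain ⟨k, hk⟩ := h
  exact ⟨k + 1, by simpa [pow_succ, Module.End.mul_apply] using hk⟩

variable {N P : Type*} [AddCommGroup N] [Module R N] [AddCommGroup P] [Module R P]

/-- A bilinear map intertwining `f`, `g` and `h` multiplies generalized eigenvalues. -/
lemma bilin_mem_maxGenEigenspace_mul {f : End R M} {g : End R N} {h : End R P}
    (B : M →ₗ[R] N →ₗ[R] P) (hB : ∀ x y, h (B x y) = B (f x) (g y)) {a b : R} {x : M} {y : N}
    (hx : x ∈ f.maxGenEigenspace a) (hy : y ∈ g.maxGenEigenspace b) :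
    B x y ∈ h.maxGenEigenspace (a * b) := by
  rw [mem_maxGenEigenspace] at hx hy
  obtain ⟨k, hk⟩ := hx
  obtain ⟨l, hl⟩ := hy
  induction k generalizing x y l with
  | zero =>
    obtain rfl : x = 0 := by simpa using hk
    simp
  | succ k ihk =>
    induction l generalizing y with
    | zero =>
      obtain rfl : y = 0 := by simpa using hl
      simp
    | succ l ihl =>
      have hk' : ((f - a • 1) ^ k) (f x - a • x) = 0 := by
        simpa [pow_succ, Module.End.mul_apply] using hk
      have hl' : ((g - b • 1) ^ l) (g y - b • y) = 0 := by
        simpa [pow_succ, Module.End.mul_apply] using hl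
      apply mem_maxGenEigenspace_of_sub_mem
      have key : h (B x y) - (a * b) • B x y =
          B (f x - a • x) (g y - b • y) + b • B (f x - a • x) y + a • B x (g y - b • y) := by
        rw [hB]
        simp only [map_sub, map_smul, LinearMap.sub_apply, LinearMap.smul_apply]
        module
      rw [key]
      exact add_mem (add_mem (ihk hk' l hl') (Submodule.smul_mem _ _ (ihk hk' (l + 1) hl)))
        (Submodule.smul_mem _ _ (ihl hl'))

end

end Module.End

/-- For a multiplicatively closed set `S` of scalars, the sum of the generalized eigenspaces of a
Lie algebra endomorphism with eigenvalues in `S` is closed under the bracket. -/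
lemma LieHom.lie_mem_iSup_maxGenEigenspace {R L : Type*} [CommRing R] [LieRing L]
    [LieAlgebra R L] (ρ : L →ₗ⁅R⁆ L) {S : Set R} (hS : ∀ a ∈ S, ∀ b ∈ S, a * b ∈ S) {x y : L}
    (hx : x ∈ ⨆ a ∈ S, Module.End.maxGenEigenspace (ρ : L →ₗ[R] L) a)
    (hy : y ∈ ⨆ a ∈ S, Module.End.maxGenEigenspace (ρ : L →ₗ[R] L) a) :
    ⁅x, y⁆ ∈ ⨆ a ∈ S, Module.End.maxGenEigenspace (ρ : L →ₗ[R] L) a := by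
  let B : L →ₗ[R] L →ₗ[R] L := LieModule.toEnd R L L
  set V := ⨆ a ∈ S, Module.End.maxGenEigenspace (ρ : L →ₗ[R] L) a with hV
  have hB : Submodule.map₂ B V V ≤ V := by
    simp only [hV, Submodule.map₂_iSup_left, Submodule.map₂_iSup_right, iSup_le_iff]
    intro b hb a ha
    refine le_trans (Submodule.map₂_le.2 fun u hu v hv => ?_)
      (le_iSup₂_of_le (a * b) (hS a ha b hb) le_rfl)
    exact Module.End.bilin_mem_maxGenEigenspace_mul B (fun u v => ρ.map_lie u v) hu hv
  exact hB (Submodule.apply_mem_map₂ B hx hy)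


/-- For a Lie algebra automorphism `ρ` of a finite-dimensional complex Lie algebra
`𝔤`, each of the subspaces `𝔤⁺`, `𝔤⁰`, `𝔤⁻` (the sums of the generalized eigenspaces
of `ρ` for eigenvalues of modulus `> 1`, `= 1`, `< 1`, respectively) is closed under
the Lie bracket. -/
theorem dynamical_subspaces_bracket_closed {L : Type*} [LieRing L] [LieAlgebra ℂ L]
    [Module.Finite ℂ L] (ρ : L ≃ₗ⁅ℂ⁆ L)
    (gplus gzero gminus : Submodule ℂ L)
    (hplus : gplus = ⨆ α ∈ {α : ℂ | 1 < ‖α‖},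
      Module.End.maxGenEigenspace (ρ.toLinearEquiv : L →ₗ[ℂ] L) α)
    (hzero : gzero = ⨆ α ∈ {α : ℂ | ‖α‖ = 1},
      Module.End.maxGenEigenspace (ρ.toLinearEquiv : L →ₗ[ℂ] L) α)
    (hminus : gminus = ⨆ α ∈ {α : ℂ | ‖α‖ < 1},
      Module.End.maxGenEigenspace (ρ.toLinearEquiv : L →ₗ[ℂ] L) α) :
    (∀ X Y : L, X ∈ gplus → Y ∈ gplus → ⁅X, Y⁆ ∈ gplus) ∧
      (∀ X Y : L, X ∈ gzero → Y ∈ gzero → ⁅X, Y⁆ ∈ gzero) ∧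
      (∀ X Y : L, X ∈ gminus → Y ∈ gminus → ⁅X, Y⁆ ∈ gminus) := by
  subst hplus hzero hminus
  refine ⟨fun X Y hX hY => ?_, fun X Y hX hY => ?_, fun X Y hX hY => ?_⟩
  · refine LieHom.lie_mem_iSup_maxGenEigenspace (ρ : L →ₗ⁅ℂ⁆ L) (fun a ha b hb => ?_) hX hY
    simpa using one_lt_mul_of_lt_of_le ha (le_of_lt hb)
  · refine LieHom.lie_mem_iSup_maxGenEigenspace (ρ : L →ₗ⁅ℂ⁆ L) (fun a ha b hb => ?_) hX hY
    simp_all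
  · refine LieHom.lie_mem_iSup_maxGenEigenspace (ρ : L →ₗ⁅ℂ⁆ L) (fun a ha b hb => ?_) hX hY
    simpa using mul_lt_one_of_nonneg_of_lt_one_left (norm_nonneg a) ha (le_of_lt hb)
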